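/- For every N ∈ ℕ, the matrix Â_N ∈ ℤ^{D_N×D_N} with entries Â_N(t,d) = gcd(t,N/t)·N·gcd(d,t)²/(d·gcd(t²,N)) is invertible over ℚ. Consequently, if X, X' : D_N → ℤ satisfy Â_N X = Â_N X' (i.e., the eta quotients η^X and η^{X'} have the same orders at all cusps 1/t, t | N, of Γ₀(N)), then X = X'. -/

import Mathlib

open Finset

/-- The entry of the symmetrized order matrix `Â_N` at `(t, d)`:
`Â_N(t,d) = gcd(t, N/t) · N · gcd(d,t)² / (d · gcd(t², N))`. -/
def Ahat (N t d : ℕ) : ℚ :=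
  (Nat.gcd t (N / t) : ℚ) *
    ((N : ℚ) * (Nat.gcd d t : ℚ) ^ 2 / ((d : ℚ) * (Nat.gcd (t ^ 2) N : ℚ)))

/-- The symmetrized order matrix `Â_N`, indexed by the divisors of `N`. -/
def AhatMatrix (N : ℕ) :
    Matrix {x : ℕ // x ∈ N.divisors} {x : ℕ // x ∈ N.divisors} ℚ :=
  fun t d => Ahat N t.1 d.1

/-- Gauss's identity `∑_{a ∣ n} φ(a) = n` for `n = gcd(d, t)`, summed over the divisors of a
multiple `N` of `d`. -/
lemma gcd_eq_sum_totient {N d : ℕ} (t : ℕ) (hd : d ∈ N.divisors) :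
    (Nat.gcd d t : ℚ) =
      ∑ a ∈ N.divisors, (a.totient : ℚ) * (if a ∣ d then 1 else 0) * (if a ∣ t then 1 else 0) := by
  obtain ⟨hdN, hN⟩ := Nat.mem_divisors.1 hd
  have hfilter : N.divisors.filter (fun a => a ∣ d ∧ a ∣ t) = (Nat.gcd d t).divisors := by
    ext a
    have hg : Nat.gcd d t ≠ 0 :=
      Nat.gcd_ne_zero_left (ne_zero_of_dvd_ne_zero hN hdN)
    simp only [mem_filter, Nat.mem_divisors, Nat.dvd_gcd_iff]
    exact ⟨fun h => ⟨h.2, hg⟩, fun h => ⟨⟨h.1.1.trans hdN, hN⟩, h.1⟩⟩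
  conv_lhs => rw [← Nat.sum_totient (Nat.gcd d t), ← hfilter, sum_filter]
  push_cast
  refine sum_congr rfl fun a _ => ?_
  by_cases h₁ : a ∣ d <;> by_cases h₂ : a ∣ t <;> simp [h₁, h₂]

/-- The quadratic form of the matrix `gcd(d, t)²` as a sum of weighted squares. -/
lemma sum_gcd_sq_mul_mul_eq (N : ℕ) (y : ℕ → ℚ) :
    ∑ t ∈ N.divisors, ∑ d ∈ N.divisors, (Nat.gcd d t : ℚ) ^ 2 * y d * y t =
      ∑ a ∈ N.divisors, ∑ b ∈ N.divisors, (a.totient : ℚ) * b.totient *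
        (∑ d ∈ N.divisors, (if a ∣ d then 1 else 0) * (if b ∣ d then 1 else 0) * y d) ^ 2 := by
  have hterm : ∀ t ∈ N.divisors, ∀ d ∈ N.divisors, (Nat.gcd d t : ℚ) ^ 2 * y d * y t =
      ∑ a ∈ N.divisors, ∑ b ∈ N.divisors, (a.totient : ℚ) * b.totient *
        (((if a ∣ t then 1 else 0) * (if b ∣ t then 1 else 0) * y t) *
          ((if a ∣ d then 1 else 0) * (if b ∣ d then 1 else 0) * y d)) := by
    intro t _ d hd
    rw [gcd_eq_sum_totient t hd, sq, sum_mul_sum, sum_mul, sum_mul]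
    refine sum_congr rfl fun a _ => ?_
    rw [sum_mul, sum_mul]
    refine sum_congr rfl fun b _ => ?_
    ring
  rw [sum_congr rfl fun t ht => sum_congr rfl (hterm t ht)]
  simp_rw [sq, sum_mul_sum, mul_sum]
  rw [sum_congr rfl fun t _ => sum_comm, sum_comm]
  refine sum_congr rfl fun a _ => ?_
  rw [sum_congr rfl fun t _ => sum_comm, sum_comm]

/-- A function on the divisors of `N` all of whose sums over multiples vanish is zero. -/
lemma eq_zero_of_sum_multiples_eq_zero {N : ℕ} {y : ℕ → ℚ}
    (h : ∀ a ∈ N.divisors, ∑ d ∈ N.divisors with a ∣ d, y d = 0) :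
    ∀ d ∈ N.divisors, y d = 0 := by
  by_contra! hne
  obtain ⟨d₀, hd₀, hy₀⟩ := hne
  obtain ⟨m, hm, hmax⟩ := exists_max_image (N.divisors.filter (y · ≠ 0)) id
    ⟨d₀, mem_filter.2 ⟨hd₀, hy₀⟩⟩
  obtain ⟨hmN, hym⟩ := mem_filter.1 hm
  refine hym ?_
  rw [← h m hmN, sum_eq_single_of_mem m (mem_filter.2 ⟨hmN, dvd_rfl⟩)]
  intro d hd hdm
  obtain ⟨hdN, hmd⟩ := mem_filter.1 hd
  by_contra hyd
  exact hdm (le_antisymm (hmax d (mem_filter.2 ⟨hdN, hyd⟩))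
    (Nat.le_of_dvd (Nat.pos_of_mem_divisors hdN) hmd))

/-- The matrix `gcd(d, t)²` on the divisors of `N` has trivial kernel. -/
lemma eq_zero_of_sum_gcd_sq_mul_eq_zero {N : ℕ} {y : ℕ → ℚ}
    (h : ∀ t ∈ N.divisors, ∑ d ∈ N.divisors, (Nat.gcd d t : ℚ) ^ 2 * y d = 0) :
    ∀ d ∈ N.divisors, y d = 0 := by
  refine eq_zero_of_sum_multiples_eq_zero fun a ha => ?_
  have hform := sum_gcd_sq_mul_mul_eq N y
  rw [sum_eq_zero fun t ht => by rw [← sum_mul, h t ht, zero_mul], eq_comm,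
    sum_eq_zero_iff_of_nonneg fun _ _ => sum_nonneg fun _ _ => by positivity] at hform
  have hone : 1 ∈ N.divisors := Nat.one_mem_divisors.2 (Nat.mem_divisors.1 ha).2
  have hsq := (sum_eq_zero_iff_of_nonneg fun _ _ => by positivity).1 (hform a ha) 1 hone
  have ha' : (a.totient : ℚ) ≠ 0 := by
    exact_mod_cast (Nat.totient_pos.2 (Nat.pos_of_mem_divisors ha)).ne'
  simpa [ha', sum_filter] using hsq

/-- `Â_N` has trivial kernel. -/
lemma eq_zero_of_sum_Ahat_mul_eq_zero {N : ℕ} {x : ℕ → ℚ}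
    (h : ∀ t ∈ N.divisors, ∑ d ∈ N.divisors, Ahat N t d * x d = 0) :
    ∀ d ∈ N.divisors, x d = 0 := by
  intro d hd
  have hN : N ≠ 0 := (Nat.mem_divisors.1 hd).2
  have hy : ∀ d ∈ N.divisors, x d / d = 0 := by
    refine eq_zero_of_sum_gcd_sq_mul_eq_zero fun t ht => ?_
    have ht₀ : t ≠ 0 := (Nat.pos_of_mem_divisors ht).ne'
    have hc : (Nat.gcd t (N / t) : ℚ) * N / (Nat.gcd (t ^ 2) N : ℚ) ≠ 0 := by
      have h₁ : (Nat.gcd t (N / t) : ℚ) ≠ 0 := by exact_mod_cast Nat.gcd_ne_zero_left ht₀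
      have h₂ : (Nat.gcd (t ^ 2) N : ℚ) ≠ 0 := by exact_mod_cast Nat.gcd_ne_zero_right hN
      have h₃ : (N : ℚ) ≠ 0 := by exact_mod_cast hN
      positivity
    refine (mul_eq_zero.1 ?_).resolve_left hc
    rw [← h t ht, mul_sum]
    refine sum_congr rfl fun d _ => ?_
    simp only [Ahat, div_eq_mul_inv, mul_inv]
    ring
  have hd₀ : (d : ℚ) ≠ 0 := by exact_mod_cast (Nat.pos_of_mem_divisors hd).ne'
  exact (div_eq_zero_iff.1 (hy d hd)).resolve_right hd₀

/-- For every `N ∈ ℕ`, the symmetrized order matrix `Â_N` is invertible over `ℚ`;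
consequently, if `Â_N X = Â_N X'` (the eta quotients `η^X` and `η^{X'}` have the same
orders at all cusps `1/t`, `t ∣ N`, of `Γ₀(N)`), then `X = X'` on the divisors. -/
theorem AhatMatrix_invertible_and_injective (N : ℕ) (hN : 0 < N) :
    IsUnit (AhatMatrix N) ∧
    ∀ X X' : ℕ → ℤ,
      (∀ t ∈ N.divisors,
        (∑ d ∈ N.divisors, Ahat N t d * (X d : ℚ)) =
          ∑ d ∈ N.divisors, Ahat N t d * (X' d : ℚ)) →
      ∀ d ∈ N.divisors, X d = X' d := by
  constructor
  · rw [← Matrix.mulVec_injective_iff_isUnit, ← Matrix.coe_mulVecLin, injective_iff_map_eq_zero]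
    intro v hv
    have hx := eq_zero_of_sum_Ahat_mul_eq_zero (N := N)
      (x := fun d => if hd : d ∈ N.divisors then v ⟨d, hd⟩ else 0) fun t ht => by
        rw [← sum_coe_sort]
        simpa [Matrix.mulVec, dotProduct, AhatMatrix] using congrFun hv ⟨t, ht⟩
    funext ⟨d, hd⟩
    simpa only [dif_pos hd, Pi.zero_apply] using hx d hd
  · intro X X' h d hd
    have hx := eq_zero_of_sum_Ahat_mul_eq_zero (N := N) (x := fun d => (X d : ℚ) - X' d)
      (fun t ht => by simp only [mul_sub, sum_sub_distrib, h t ht, sub_self]) d hd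
    exact_mod_cast sub_eq_zero.1 hx
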